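/- arXiv:2402.02949 — 2 statements merged into one kernel-verified Lean document; each statement's English description precedes it below -/
import Mathlib

section
/- The Gaussian kernel is a positive semidefinite kernel: for every γ > 0, every natural number n, every family z₁, …, zₙ of vectors in ℝ^m, and every family of real coefficients c₁, …, cₙ, one has Σᵢ Σⱼ cᵢ cⱼ exp(−γ ‖zᵢ − zⱼ‖₂²) ≥ 0; equivalently, the n × n matrix K with entries K_{ij} = exp(−γ ‖zᵢ − zⱼ‖₂²) is positive semidefinite. -/
namespace Matrix.PosSemidef

variable {ι : Type*} [Fintype ι] {A : Matrix ι ι ℝ}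

theorem _root_.Matrix.posSemidef_real_iff_sum :
    A.PosSemidef ↔ A.IsHermitian ∧ ∀ x : ι → ℝ, 0 ≤ ∑ i, ∑ j, x i * x j * A i j := by
  rw [posSemidef_iff_dotProduct_mulVec]
  simp only [dotProduct, mulVec, Pi.star_apply, star_trivial, Finset.mul_sum, mul_assoc,
    mul_comm (A _ _)]

theorem map_pow (hA : A.PosSemidef) (k : ℕ) : (A.map (· ^ k)).PosSemidef := by
  induction k with
  | zero =>
    convert posSemidef_vecMulVec_self_star (fun _ : ι => (1 : ℝ)) using 1
    ext i j
    simp [vecMulVec_apply]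
  | succ k ih =>
    have hmul : A.map (· ^ (k + 1)) = A.map (· ^ k) ⊙ A := by
      ext i j
      simp [pow_succ]
    rw [hmul]
    exact ih.hadamard hA

theorem map_exp (hA : A.PosSemidef) : (A.map Real.exp).PosSemidef := by
  refine posSemidef_real_iff_sum.2 ⟨hA.isHermitian.map _ fun _ => rfl, fun x => ?_⟩
  have hsum : HasSum (fun k : ℕ => ∑ i, ∑ j, x i * x j * (A i j ^ k / k.factorial))
      (∑ i, ∑ j, x i * x j * Real.exp (A i j)) :=
    hasSum_sum fun i _ => hasSum_sum fun j _ => by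
      rw [Real.exp_eq_exp_ℝ]
      exact (NormedSpace.expSeries_div_hasSum_exp (A i j)).mul_left _
  refine hsum.nonneg fun k => ?_
  have hk := (posSemidef_real_iff_sum.1 (hA.map_pow k)).2 x
  simp only [← mul_div_assoc, ← Finset.sum_div]
  exact div_nonneg hk (Nat.cast_nonneg _)

end Matrix.PosSemidef

theorem Matrix.posSemidef_exp_neg_mul_norm_sub_sq {ι E : Type*} [Fintype ι]
    [NormedAddCommGroup E] [InnerProductSpace ℝ E] {γ : ℝ} (hγ : 0 ≤ γ) (z : ι → E) :
    (Matrix.of fun i j => Real.exp (-γ * ‖z i - z j‖ ^ 2)).PosSemidef := by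
  have hgram := ((posSemidef_gram ℝ z).smul (mul_nonneg zero_le_two hγ)).map_exp
  have hdiag := posSemidef_vecMulVec_self_star fun i => Real.exp (-γ * ‖z i‖ ^ 2)
  refine (congrArg PosSemidef ?_).mpr (hdiag.hadamard hgram)
  ext i j
  simp only [of_apply, hadamard_apply, vecMulVec_apply, star_trivial, map_apply,
    smul_apply, gram_apply, smul_eq_mul, ← Real.exp_add, norm_sub_sq_real]
  ring_nf

/-- The Gaussian kernel is positive semidefinite: for every `γ > 0`, any family
of vectors `z i ∈ ℝ^m` and real coefficients `c i`,
`Σᵢ Σⱼ cᵢ cⱼ exp(−γ ‖zᵢ − zⱼ‖²) ≥ 0`; equivalently, the matrix `K` with entries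
`K i j = exp(−γ ‖zᵢ − zⱼ‖²)` is positive semidefinite. -/
theorem gaussian_kernel_posSemidef
    (m : ℕ) (γ : ℝ) (hγ : 0 < γ) (n : ℕ)
    (z : Fin n → EuclideanSpace ℝ (Fin m)) (c : Fin n → ℝ) :
    0 ≤ ∑ i, ∑ j, c i * c j * Real.exp (-γ * ‖z i - z j‖ ^ 2) ∧
    (Matrix.of fun i j : Fin n => Real.exp (-γ * ‖z i - z j‖ ^ 2)).PosSemidef := by
  have h := Matrix.posSemidef_exp_neg_mul_norm_sub_sq hγ.le z
  exact ⟨(Matrix.posSemidef_real_iff_sum.1 h).2 c, h⟩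
end

section
/- Let γ > 0, let M be a positive natural number, and for i = 1, …, M let (ωᵢ, uᵢ) be independent random pairs where ωᵢ is multivariate Gaussian in ℝ^m with mean 0 and covariance 2γ I_m, uᵢ ∼ Uniform(0, 2π), and ωᵢ is independent of uᵢ. Define the random Fourier features map φ_RFF(z) = √(2/M) (cos(zᵀ ω₁ + u₁), …, cos(zᵀ ω_M + u_M)) ∈ ℝ^M. Then for all z₁, z₂ ∈ ℝ^m, the inner product of the mapped features is an unbiased estimator of the Gaussian kernel: E[ φ_RFF(z₁)ᵀ φ_RFF(z₂) ] = exp(−γ ‖z₁ − z₂‖₂²). -/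
open Real MeasureTheory Matrix ProbabilityTheory

theorem integral_cos_dotProduct_pi_gaussianReal {ι : Type*} [Fintype ι] (v : NNReal)
    (t : ι → ℝ) :
    ∫ w, Real.cos (t ⬝ᵥ w) ∂(Measure.pi fun _ : ι => gaussianReal 0 v) =
      Real.exp (-(v / 2) * ∑ i, t i ^ 2) := by
  have hexp : ∀ w : ι → ℝ, Complex.exp (↑(t ⬝ᵥ w) * Complex.I) =
      ∏ i, Complex.exp (t i * w i * Complex.I) := fun w => by
    rw [← Complex.exp_sum, ← Finset.sum_mul]
    simp [dotProduct]
  have hint : Integrable (fun w : ι → ℝ => Complex.exp (↑(t ⬝ᵥ w) * Complex.I))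
      (Measure.pi fun _ : ι => gaussianReal 0 v) := by
    refine Integrable.of_bound (C := 1) ?_ (.of_forall fun w => ?_)
    · refine Continuous.aestronglyMeasurable ?_
      simp only [dotProduct]
      fun_prop
    · rw [Complex.norm_exp_ofReal_mul_I]
  have hfun : ∀ i, ∫ x : ℝ, Complex.exp (t i * x * Complex.I) ∂gaussianReal 0 v =
      Complex.exp (↑(-(v / 2) * t i ^ 2 : ℝ)) := fun i => by
    rw [← charFun_apply_real, charFun_gaussianReal]
    congr 1
    push_cast
    ring
  have hval : ∫ w : ι → ℝ, Complex.exp (↑(t ⬝ᵥ w) * Complex.I)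
      ∂(Measure.pi fun _ : ι => gaussianReal 0 v) =
      ↑(Real.exp (-(v / 2) * ∑ i, t i ^ 2)) := by
    simp_rw [hexp]
    rw [integral_fintype_prod_eq_prod (fun i (x : ℝ) => Complex.exp (t i * x * Complex.I))]
    simp_rw [hfun]
    rw [← Complex.exp_sum, Complex.ofReal_exp, Finset.mul_sum, Complex.ofReal_sum]
  have hre := integral_re hint
  rw [hval] at hre
  simpa only [RCLike.re_to_complex, Complex.exp_ofReal_mul_I_re, Complex.ofReal_re] using hre

theorem integral_cos_add_mul_cos_add (a b : ℝ) :
    ∫ u in (0 : ℝ)..2 * π, Real.cos (a + u) * Real.cos (b + u) = π * Real.cos (a - b) := by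
  have hprod : ∀ u : ℝ, Real.cos (a + u) * Real.cos (b + u) =
      (Real.cos (a - b) + Real.cos (2 * u + (a + b))) / 2 := fun u => by
    have h := Real.two_mul_cos_mul_cos (a + u) (b + u)
    rw [show a + u - (b + u) = a - b by ring,
      show a + u + (b + u) = 2 * u + (a + b) by ring] at h
    linarith
  simp_rw [hprod]
  rw [intervalIntegral.integral_div, intervalIntegral.integral_add
    (by simp) (Continuous.intervalIntegrable (by fun_prop) _ _),
    intervalIntegral.integral_comp_mul_add _ two_ne_zero, integral_cos,
    show 2 * (2 * π) + (a + b) = (a + b) + 2 * π + 2 * π by ring,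
    Real.sin_add_two_pi, Real.sin_add_two_pi]
  simp
  ring

theorem isProbabilityMeasure_uniform_zero_two_pi : IsProbabilityMeasure
    ((ENNReal.ofReal (2 * π))⁻¹ • volume.restrict (Set.Icc (0 : ℝ) (2 * π))) := by
  refine ⟨?_⟩
  simp only [Measure.smul_apply, Measure.restrict_apply_univ, Real.volume_Icc, sub_zero,
    smul_eq_mul]
  exact ENNReal.inv_mul_cancel (by simp [Real.pi_pos]) ENNReal.ofReal_ne_top

theorem integral_cos_add_mul_cos_add_uniform (a b : ℝ) :
    ∫ u, Real.cos (a + u) * Real.cos (b + u)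
      ∂((ENNReal.ofReal (2 * π))⁻¹ • volume.restrict (Set.Icc (0 : ℝ) (2 * π))) =
      Real.cos (a - b) / 2 := by
  rw [integral_smul_measure, integral_Icc_eq_integral_Ioc,
    ← intervalIntegral.integral_of_le (by positivity), integral_cos_add_mul_cos_add,
    ENNReal.toReal_inv, ENNReal.toReal_ofReal (by positivity), smul_eq_mul]
  field_simp

theorem integrable_cos_mul_cos_dotProduct {ι : Type*} [Fintype ι] (z₁ z₂ : ι → ℝ)
    (ρ : Measure ((ι → ℝ) × ℝ)) [IsFiniteMeasure ρ] :
    Integrable (fun p => Real.cos (z₁ ⬝ᵥ p.1 + p.2) * Real.cos (z₂ ⬝ᵥ p.1 + p.2)) ρ := by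
  refine Integrable.of_bound (C := 1) ?_ (.of_forall fun p => ?_)
  · refine Continuous.aestronglyMeasurable ?_
    simp only [dotProduct]
    fun_prop
  · rw [norm_mul]
    exact mul_le_one₀ (Real.abs_cos_le_one _) (norm_nonneg _) (Real.abs_cos_le_one _)

/-- With `M` i.i.d. pairs `(ωᵢ, uᵢ)`, where `ωᵢ ∼ N(0, 2γ I_m)` in `ℝ^m` is
independent of `uᵢ ∼ Uniform(0, 2π)`, the random Fourier features map
`φ_RFF(z) = √(2/M) (cos(zᵀω₁ + u₁), …, cos(zᵀω_M + u_M))` satisfies, for all `z₁ z₂ ∈ ℝ^m`,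
`E[φ_RFF(z₁)ᵀ φ_RFF(z₂)] = exp(−γ ‖z₁ − z₂‖₂²)` (the i.i.d. and independence structure is
encoded by the product measure). -/
theorem rff_unbiased_gaussian_kernel
    (m : ℕ) (γ : ℝ) (hγ : 0 < γ) (M : ℕ) (hM : 0 < M)
    (μω : Measure (Fin m → ℝ))
    (hμω : μω = Measure.pi fun _ : Fin m => gaussianReal 0 (Real.toNNReal (2 * γ)))
    (μu : Measure ℝ)
    (hμu : μu = (ENNReal.ofReal (2 * π))⁻¹ • volume.restrict (Set.Icc (0:ℝ) (2 * π)))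
    (μ : Measure (Fin M → (Fin m → ℝ) × ℝ))
    (hμ : μ = Measure.pi fun _ : Fin M => μω.prod μu)
    (φ : (Fin m → ℝ) → (Fin M → (Fin m → ℝ) × ℝ) → Fin M → ℝ)
    (hφ : φ = fun z s i => Real.sqrt (2 / (M : ℝ)) * Real.cos (z ⬝ᵥ (s i).1 + (s i).2))
    (z₁ z₂ : Fin m → ℝ) :
    (∫ s, (φ z₁ s) ⬝ᵥ (φ z₂ s) ∂μ) =
      Real.exp (-γ * ‖(WithLp.equiv 2 (Fin m → ℝ)).symm (z₁ - z₂)‖ ^ 2) := by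
  have hω : IsProbabilityMeasure μω := by rw [hμω]; infer_instance
  have hu : IsProbabilityMeasure μu := hμu ▸ isProbabilityMeasure_uniform_zero_two_pi
  set f : (Fin m → ℝ) × ℝ → ℝ :=
    fun p => Real.cos (z₁ ⬝ᵥ p.1 + p.2) * Real.cos (z₂ ⬝ᵥ p.1 + p.2) with hf
  have hfint : Integrable f (μω.prod μu) := integrable_cos_mul_cos_dotProduct z₁ z₂ _
  have hpair : ∫ p, f p ∂(μω.prod μu) =
      Real.exp (-γ * ‖(WithLp.equiv 2 (Fin m → ℝ)).symm (z₁ - z₂)‖ ^ 2) / 2 := by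
    rw [integral_prod _ hfint]
    simp_rw [hf, hμu, integral_cos_add_mul_cos_add_uniform, ← sub_dotProduct]
    rw [integral_div, hμω, integral_cos_dotProduct_pi_gaussianReal,
      Real.coe_toNNReal _ (by positivity), EuclideanSpace.real_norm_sq_eq]
    simp
  have hdot : ∀ s, φ z₁ s ⬝ᵥ φ z₂ s = 2 / (M : ℝ) * ∑ i, f (s i) := fun s => by
    rw [hφ, dotProduct, Finset.mul_sum]
    refine Finset.sum_congr rfl fun i _ => ?_
    rw [mul_mul_mul_comm, Real.mul_self_sqrt (by positivity)]
  have hfint_eval : ∀ i, Integrable (fun s : Fin M → (Fin m → ℝ) × ℝ => f (s i)) μ := fun i => by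
    rw [hμ]
    exact integrable_comp_eval (μ := fun _ : Fin M => μω.prod μu) hfint
  have heval : ∀ i, ∫ s, f (s i) ∂μ = ∫ p, f p ∂(μω.prod μu) := fun i => by
    rw [hμ]
    exact integral_comp_eval (μ := fun _ : Fin M => μω.prod μu) hfint.aestronglyMeasurable
  simp_rw [hdot]
  rw [integral_const_mul, integral_finsetSum _ fun i _ => hfint_eval i]
  simp_rw [heval, hpair]
  have hM' : (M : ℝ) ≠ 0 := by positivity
  rw [Finset.sum_const, Finset.card_univ, Fintype.card_fin, nsmul_eq_mul]
  field_simp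
end
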